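/- Let β_j = (3+j) j! / Γ(j + 7/2) for j ∈ ℕ. Then ∫₀^∞ r^6 (1+r²)^{−7} (1 − 2/(1+r²)) ( Σ_{j=0}^∞ β_j P_j^{(5/2,5/2)}(1 − 2/(1+r²)) )² dr = 1/288, where for each r > 0 the series Σ_{j=0}^∞ β_j P_j^{(5/2,5/2)}(1 − 2/(1+r²)) converges absolutely. -/

import Mathlib

open MeasureTheory

/-- The Jacobi polynomial `P_j^{(σ,σ)}`, via the Rodrigues formula. -/
noncomputable def jacobiP (σ : ℝ) (j : ℕ) (x : ℝ) : ℝ :=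
  ((-1 : ℝ) ^ j / (2 ^ j * (Nat.factorial j : ℝ))) * (1 - x ^ 2) ^ (-σ) *
    iteratedDeriv j (fun t : ℝ => (1 - t ^ 2) ^ (σ + (j : ℝ))) x

noncomputable def β (j : ℕ) : ℝ := ((3 : ℝ) + j) * (Nat.factorial j : ℝ) / Real.Gamma (j + 7 / 2)

open Polynomial Filter Topology

/-- The Gegenbauer polynomial `C_j^{(l)}`, generated by its raising operator. -/
noncomputable def gegenbauer (l : ℝ) : ℕ → ℝ[X]
  | 0 => 1
  | j + 1 => C (1 / ((j : ℝ) + 1)) *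
      (((j : ℝ[X]) + 2 * C l) * X * gegenbauer l j - (1 - X ^ 2) * derivative (gegenbauer l j))

namespace gegenbauer

lemma zero (l : ℝ) : gegenbauer l 0 = 1 := rfl

lemma succ_ne (j : ℕ) : ((j : ℝ[X]) + 1) ≠ 0 := by exact_mod_cast Nat.succ_ne_zero j

lemma raise (l : ℝ) (j : ℕ) : ((j : ℝ[X]) + 1) * gegenbauer l (j + 1) =
    ((j : ℝ[X]) + 2 * C l) * X * gegenbauer l j - (1 - X ^ 2) * derivative (gegenbauer l j) := by
  have h : ((j : ℝ[X]) + 1) * C (1 / ((j : ℝ) + 1)) = 1 := by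
    have : ((j : ℝ[X]) + 1) = C ((j : ℝ) + 1) := by simp
    rw [this, ← C_mul, mul_one_div_cancel (by positivity), C_1]
  rw [gegenbauer, ← mul_assoc, h, one_mul]

lemma one (l : ℝ) : gegenbauer l 1 = 2 * C l * X := by
  have := raise l 0
  simpa [zero] using this

lemma derivative_raise (l : ℝ) (j : ℕ) : ((j : ℝ[X]) + 1) * derivative (gegenbauer l (j + 1)) =
    ((j : ℝ[X]) + 2 * C l) * (gegenbauer l j + X * derivative (gegenbauer l j))
      + 2 * X * derivative (gegenbauer l j)
      - (1 - X ^ 2) * derivative (derivative (gegenbauer l j)) := by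
  have h := congrArg derivative (raise l j)
  simp only [derivative_mul, derivative_add, derivative_sub, derivative_one, derivative_natCast,
    derivative_C, derivative_X_pow, derivative_X, derivative_ofNat] at h
  simp [map_ofNat] at h
  linear_combination h

lemma ode_aux (l : ℝ) (j : ℕ) :
    (1 - X ^ 2) * derivative (derivative (gegenbauer l j))
      - (2 * C l + 1) * X * derivative (gegenbauer l j)
      + (j : ℝ[X]) * ((j : ℝ[X]) + 2 * C l) * gegenbauer l j = 0 ∧
    derivative (gegenbauer l (j + 1)) =
      ((j : ℝ[X]) + 2 * C l) * gegenbauer l j + X * derivative (gegenbauer l j) := by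
  have key : ∀ j : ℕ, (1 - X ^ 2) * derivative (derivative (gegenbauer l j))
      - (2 * C l + 1) * X * derivative (gegenbauer l j)
      + (j : ℝ[X]) * ((j : ℝ[X]) + 2 * C l) * gegenbauer l j = 0 →
      derivative (gegenbauer l (j + 1)) =
      ((j : ℝ[X]) + 2 * C l) * gegenbauer l j + X * derivative (gegenbauer l j) := by
    intro j h
    apply mul_left_cancel₀ (succ_ne j)
    linear_combination derivative_raise l j - h
  suffices h : (1 - X ^ 2) * derivative (derivative (gegenbauer l j))
      - (2 * C l + 1) * X * derivative (gegenbauer l j)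
      + (j : ℝ[X]) * ((j : ℝ[X]) + 2 * C l) * gegenbauer l j = 0 from ⟨h, key j h⟩
  induction j with
  | zero => simp [zero]
  | succ j ih =>
    have hN := key j ih
    have hL := raise l j
    have hM : (1 - X ^ 2) * derivative (gegenbauer l (j + 1)) =
        ((j : ℝ[X]) + 2 * C l) * gegenbauer l j - ((j : ℝ[X]) + 1) * X * gegenbauer l (j + 1) := by
      linear_combination (1 - X ^ 2) * hN + X * hL
    have h := congrArg derivative hM
    simp only [derivative_mul, derivative_add, derivative_sub, derivative_one, derivative_natCast,
      derivative_C, derivative_X_pow, derivative_X, derivative_ofNat] at h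
    simp [map_ofNat] at h
    push_cast
    linear_combination h + ((j : ℝ[X]) + 2 * C l) * (-X * hN + hL)

/-- The Gegenbauer differential equation. -/
lemma ode (l : ℝ) (j : ℕ) :
    (1 - X ^ 2) * derivative (derivative (gegenbauer l j))
      - (2 * C l + 1) * X * derivative (gegenbauer l j)
      + (j : ℝ[X]) * ((j : ℝ[X]) + 2 * C l) * gegenbauer l j = 0 := (ode_aux l j).1

lemma derivative_succ (l : ℝ) (j : ℕ) : derivative (gegenbauer l (j + 1)) =
      ((j : ℝ[X]) + 2 * C l) * gegenbauer l j + X * derivative (gegenbauer l j) := (ode_aux l j).2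

lemma derivative_eq (l : ℝ) (j : ℕ) : derivative (gegenbauer l j) =
    X * derivative (gegenbauer l (j + 1)) - ((j : ℝ[X]) + 1) * gegenbauer l (j + 1) := by
  linear_combination -X * derivative_succ l j + raise l j

lemma recurrence (l : ℝ) (j : ℕ) : ((j : ℝ[X]) + 2) * gegenbauer l (j + 2) =
    2 * ((j : ℝ[X]) + 1 + C l) * X * gegenbauer l (j + 1)
      - ((j : ℝ[X]) + 2 * C l) * gegenbauer l j := by
  have h := raise l (j + 1)
  push_cast at h
  linear_combination h - (1 - X ^ 2) * derivative_succ l j - X * raise l j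

lemma derivative_shift (l : ℝ) (j : ℕ) :
    derivative (gegenbauer l (j + 1)) = 2 * C l * gegenbauer (l + 1) j := by
  induction j with
  | zero => simp [zero, one]
  | succ j ih =>
    apply mul_left_cancel₀ (succ_ne j)
    have h := derivative_raise l (j + 1)
    have h2 := derivative_succ l (j + 1)
    have h3 := raise (l + 1) j
    have ih' := congrArg derivative ih
    simp only [derivative_mul, derivative_C, derivative_ofNat] at ih'
    simp only [C_add, C_1] at h3
    push_cast at h h2 h3
    linear_combination h - h2 - 2 * C l * h3 + ((j : ℝ[X]) + 2 * C l + 2) * X * ih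
      - (1 - X ^ 2) * ih'

lemma shift_recurrence {l : ℝ} (hl : l ≠ 0) (j : ℕ) : gegenbauer (l + 1) (j + 2) =
    2 * X * gegenbauer (l + 1) (j + 1) - gegenbauer (l + 1) j + gegenbauer l (j + 2) := by
  have hC : (2 * C l : ℝ[X]) ≠ 0 := mul_ne_zero two_ne_zero (C_ne_zero.2 hl)
  apply mul_left_cancel₀ hC
  have h1 := derivative_succ l (j + 2)
  have h2 := derivative_eq l (j + 1)
  push_cast at h1 h2
  linear_combination h1 + h2 - derivative_shift l (j + 2) - derivative_shift l j
    + 2 * X * derivative_shift l (j + 1)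

end gegenbauer

lemma abs_mul_le_of_recurrence {x s : ℝ} (hxs : x ^ 2 + s ^ 2 = 1) {a t : ℕ → ℝ}
    (h0 : a 0 = t 0) (h1 : a 1 = 2 * x * a 0 + t 1)
    (h : ∀ n, a (n + 2) = 2 * x * a (n + 1) - a n + t (n + 2)) (n : ℕ) :
    |s * a n| ≤ ∑ i ∈ Finset.range (n + 2), |t i| := by
  have key : ‖(⟨a (n + 1) - x * a n, s * a n⟩ : ℂ)‖ ≤ ∑ i ∈ Finset.range (n + 2), |t i| := by
    have he : ‖(⟨x, s⟩ : ℂ)‖ = 1 := by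
      rw [Complex.norm_eq_sqrt_sq_add_sq, hxs, Real.sqrt_one]
    have step : ∀ (z : ℂ) (u : ℝ), ‖(⟨x, s⟩ : ℂ) * z + (u : ℂ)‖ ≤ ‖z‖ + |u| := by
      intro z u
      refine (norm_add_le _ _).trans ?_
      rw [norm_mul, he, one_mul, Complex.norm_real, Real.norm_eq_abs]
    induction n with
    | zero =>
      have : (⟨a 1 - x * a 0, s * a 0⟩ : ℂ) = (⟨x, s⟩ : ℂ) * (t 0 : ℂ) + (t 1 : ℂ) := by
        apply Complex.ext <;> simp [h1, h0] ; ring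
      simp only [zero_add]
      rw [this]
      refine (step _ _).trans ?_
      simp [Finset.sum_range_succ]
    | succ n ih =>
      rw [Finset.sum_range_succ]
      have : (⟨a (n + 1 + 1) - x * a (n + 1), s * a (n + 1)⟩ : ℂ) =
          (⟨x, s⟩ : ℂ) * (⟨a (n + 1) - x * a n, s * a n⟩ : ℂ) + (t (n + 2) : ℂ) := by
        apply Complex.ext
        · simp [h n]; linear_combination a n * hxs
        · simp; ring
      rw [this]
      exact (step _ _).trans (by gcongr)
  exact (Complex.abs_im_le_norm _).trans key

lemma gegenbauer_bound {x s : ℝ} (hxs : x ^ 2 + s ^ 2 = 1) (n : ℕ) :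
    |s ^ 3 * (gegenbauer 3 n).eval x| ≤ ((n : ℝ) + 2) * (n + 3) := by
  have shift : ∀ l : ℝ, l ≠ 0 → ∀ (k : ℕ) (n : ℕ),
      |s ^ (k + 1) * (gegenbauer (l + 1) n).eval x| ≤
        ∑ i ∈ Finset.range (n + 2), |s ^ k * (gegenbauer l i).eval x| := by
    intro l hl k n
    have := abs_mul_le_of_recurrence hxs (a := fun n => s ^ k * (gegenbauer (l + 1) n).eval x)
      (t := fun n => s ^ k * (gegenbauer l n).eval x) (by simp [gegenbauer.zero])
      (by simp [gegenbauer.zero, gegenbauer.one]; ring)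
      (fun n => by
        have := congrArg (eval x) (gegenbauer.shift_recurrence hl n)
        simp at this
        simp only [this]; ring) n
    rwa [← mul_assoc, ← pow_succ'] at this
  have b1 : ∀ n, |s ^ 1 * (gegenbauer 1 n).eval x| ≤ 1 := by
    intro n
    have := abs_mul_le_of_recurrence hxs (a := fun n => (gegenbauer 1 n).eval x)
      (t := fun n => if n = 0 then 1 else 0) (by simp [gegenbauer.zero])
      (by simp [gegenbauer.zero, gegenbauer.one])
      (fun n => by
        have h := congrArg (eval x) (gegenbauer.recurrence 1 n)
        simp only [eval_mul, eval_add, eval_sub, eval_natCast, eval_ofNat, eval_C, eval_X,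
          eval_one] at h
        have hn : ((n : ℝ) + 2) ≠ 0 := by positivity
        apply mul_left_cancel₀ hn
        rw [if_neg (by omega)]
        linear_combination h) n
    rw [pow_one]
    refine this.trans ?_
    rw [Finset.sum_range_succ']
    simp
  have b2 : ∀ n : ℕ, |s ^ 2 * (gegenbauer 2 n).eval x| ≤ (n : ℝ) + 2 := by
    intro n
    have := shift 1 one_ne_zero 1 n
    rw [one_add_one_eq_two, one_add_one_eq_two] at this
    refine this.trans ?_
    calc _ ≤ ∑ i ∈ Finset.range (n + 2), (1 : ℝ) := Finset.sum_le_sum fun i _ => b1 i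
      _ = _ := by simp
  have := shift 2 two_ne_zero 2 n
  rw [show (2 : ℝ) + 1 = 3 by norm_num] at this
  refine this.trans ?_
  calc _ ≤ ∑ i ∈ Finset.range (n + 2), ((n : ℝ) + 3) :=
        Finset.sum_le_sum fun i hi => by
          have h2 : (i : ℝ) + 1 ≤ n + 2 := by
            exact_mod_cast Finset.mem_range.1 hi
          linarith [b2 i]
    _ = _ := by rw [Finset.sum_const, Finset.card_range, nsmul_eq_mul]; push_cast; ring

lemma iteratedDeriv_one_sub_sq_rpow (k m : ℕ) {x : ℝ} (hx : 0 < 1 - x ^ 2) :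
    iteratedDeriv k (fun t : ℝ => (1 - t ^ 2) ^ ((m : ℝ) + 1 / 2 + k)) x =
      (-1) ^ k * (k.factorial * (2 * k + 2 * m + 1).factorial * m.factorial : ℝ) /
        ((k + 2 * m + 1).factorial * 2 ^ k * (k + m).factorial) *
      ((1 - x ^ 2) ^ ((m : ℝ) + 1 / 2) * (gegenbauer ((m : ℝ) + 1) k).eval x) := by
  induction k generalizing m x with
  | zero =>
    have h1 : ((2 * m + 1).factorial : ℝ) ≠ 0 := by positivity
    have h2 : (m.factorial : ℝ) ≠ 0 := by positivity
    simp [gegenbauer.zero]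
    field_simp
  | succ k ih =>
    rw [iteratedDeriv_succ]
    have hev : iteratedDeriv k (fun t : ℝ => (1 - t ^ 2) ^ ((m : ℝ) + 1 / 2 + (k + 1 : ℕ))) =ᶠ[𝓝 x]
        fun y => (-1) ^ k * (k.factorial * (2 * k + 2 * (m + 1) + 1).factorial *
          (m + 1).factorial : ℝ) /
        ((k + 2 * (m + 1) + 1).factorial * 2 ^ k * (k + (m + 1)).factorial) *
      ((1 - y ^ 2) ^ (((m + 1 : ℕ) : ℝ) + 1 / 2) *
        (gegenbauer (((m + 1 : ℕ) : ℝ) + 1) k).eval y) := by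
      have ho : ∀ᶠ y in 𝓝 x, 0 < 1 - y ^ 2 :=
        (by fun_prop : Continuous fun y : ℝ => 1 - y ^ 2).continuousAt.eventually
          (lt_mem_nhds hx)
      filter_upwards [ho] with y hy
      rw [← ih (m + 1) hy]
      congr 1
      ext t
      congr 1
      push_cast
      ring
    rw [hev.deriv_eq]
    have hd : HasDerivAt (fun y : ℝ => (1 - y ^ 2) ^ (((m + 1 : ℕ) : ℝ) + 1 / 2) *
        (gegenbauer (((m + 1 : ℕ) : ℝ) + 1) k).eval y)
        (-((k + 1) * (k + 2 * m + 3) / (2 * (m + 1))) * ((1 - x ^ 2) ^ ((m : ℝ) + 1 / 2) *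
          (gegenbauer ((m : ℝ) + 1) (k + 1)).eval x)) x := by
      have h1 : HasDerivAt (fun y : ℝ => 1 - y ^ 2) (-(2 * x)) x := by
        simpa using (hasDerivAt_pow 2 x).const_sub 1
      have h2 := (h1.rpow_const (p := ((m + 1 : ℕ) : ℝ) + 1 / 2) (Or.inl hx.ne')).mul
        ((gegenbauer (((m + 1 : ℕ) : ℝ) + 1) k).hasDerivAt x)
      refine h2.congr_deriv ?_
      have e1 : ((m + 1 : ℕ) : ℝ) + 1 / 2 - 1 = (m : ℝ) + 1 / 2 := by push_cast; ring
      have e2 : (1 - x ^ 2) ^ (((m + 1 : ℕ) : ℝ) + 1 / 2) =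
          (1 - x ^ 2) ^ ((m : ℝ) + 1 / 2) * (1 - x ^ 2) := by
        rw [← Real.rpow_add_one hx.ne']
        congr 1
        push_cast
        ring
      rw [e1, e2]
      have g1 := gegenbauer.derivative_shift ((m : ℝ) + 1) k
      have g2 := congrArg derivative g1
      have g3 := gegenbauer.ode ((m : ℝ) + 1) (k + 1)
      simp only [derivative_mul, derivative_C, derivative_ofNat] at g2
      replace g1 := congrArg (eval x) g1
      replace g2 := congrArg (eval x) g2
      replace g3 := congrArg (eval x) g3
      simp only [eval_mul, eval_add, eval_sub, eval_natCast, eval_ofNat, eval_C, eval_X,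
          eval_one, eval_zero, eval_pow] at g1 g2 g3
      push_cast at g1 g2 g3 ⊢
      have hm : (2 * ((m : ℝ) + 1)) ≠ 0 := by positivity
      field_simp
      linear_combination g3 - (1 - x ^ 2) * g2 + (2 * m + 3) * x * g1
    rw [(hd.const_mul _).deriv]
    have f1 : (2 * k + 2 * (m + 1) + 1).factorial = (2 * (k + 1) + 2 * m + 1).factorial := by
      congr 1; ring
    have f2 : (k + 2 * (m + 1) + 1).factorial =
        (k + 2 * m + 3) * (k + 1 + 2 * m + 1).factorial := by
      rw [show k + 2 * (m + 1) + 1 = (k + 1 + 2 * m + 1) + 1 by ring, Nat.factorial_succ]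
      ring
    have f3 : (k + (m + 1)).factorial = (k + 1 + m).factorial := by congr 1; ring
    rw [f1, f2, f3, Nat.factorial_succ m, Nat.factorial_succ k]
    push_cast
    field_simp
    ring

/-- The coefficients of the series `∑ β_j P_j` in the Gegenbauer basis, up to a constant factor. -/
noncomputable def gegenbauerCoeff (j : ℕ) : ℝ :=
  1 / (((j : ℝ) + 1) * (j + 2) * (j + 4) * (j + 5))

lemma beta_mul_jacobiP (j : ℕ) {x : ℝ} (hx : 0 < 1 - x ^ 2) :
    β j * jacobiP (5 / 2) j x =
      64 / √Real.pi * (gegenbauerCoeff j * (gegenbauer 3 j).eval x) := by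
  have h := iteratedDeriv_one_sub_sq_rpow j 2 hx
  have e0 : ((2 : ℕ) : ℝ) + 1 / 2 = 5 / 2 := by norm_num
  have e1 : ((2 : ℕ) : ℝ) + 1 = 3 := by norm_num
  rw [e0, e1] at h
  have hG := Real.Gamma_mul_Gamma_add_half ((j : ℝ) + 3)
  have g1 : Real.Gamma ((j : ℝ) + 3) = (j + 2).factorial := by
    rw [← Real.Gamma_nat_eq_factorial]; congr 1; push_cast; ring
  have g2 : Real.Gamma (2 * ((j : ℝ) + 3)) = (2 * j + 5).factorial := by
    rw [← Real.Gamma_nat_eq_factorial]; congr 1; push_cast; ring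
  have g3 : (2 : ℝ) ^ (1 - 2 * ((j : ℝ) + 3)) = 1 / (2 ^ j * 2 ^ j * 32) := by
    rw [show (1 - 2 * ((j : ℝ) + 3)) = -((2 * j + 5 : ℕ) : ℝ) by push_cast; ring,
      Real.rpow_neg two_pos.le, Real.rpow_natCast, one_div]
    congr 1
    ring
  rw [g1, g2, g3, show (j : ℝ) + 3 + 1 / 2 = j + 7 / 2 by ring] at hG
  have hΓ : Real.Gamma ((j : ℝ) + 7 / 2) =
      (2 * j + 5).factorial * (1 / (2 ^ j * 2 ^ j * 32)) * √Real.pi / (j + 2).factorial := by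
    rw [eq_div_iff (by positivity)]; linear_combination hG
  have hpi : √Real.pi ≠ 0 := (Real.sqrt_pos.2 Real.pi_pos).ne'
  have hw : (1 - x ^ 2) ^ (5 / 2 : ℝ) ≠ 0 := (Real.rpow_pos_of_pos hx _).ne'
  have hs : ((-1 : ℝ) ^ j) * (-1) ^ j = 1 := by rw [← mul_pow]; simp
  rw [β, jacobiP, h, hΓ, Real.rpow_neg hx.le, gegenbauerCoeff]
  rw [show j + 2 * 2 + 1 = j + 5 by ring, show 2 * j + 2 * 2 + 1 = 2 * j + 5 by ring]
  have f5 : ((j + 5).factorial : ℝ) =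
      (j + 5) * (j + 4) * (j + 3) * (j + 2) * (j + 1) * j.factorial := by
    simp only [Nat.factorial_succ]; push_cast; ring
  rw [f5]
  simp only [Nat.factorial_two, Nat.cast_ofNat]
  field_simp
  rw [show ((-1 : ℝ) ^ j) ^ 2 = 1 by rw [sq]; exact hs]
  ring

lemma stereo_mem (r : ℝ) : (1 - 2 / (1 + r ^ 2)) ∈ Set.Icc (-1 : ℝ) 1 := by
  have h : 0 < 1 + r ^ 2 := by positivity
  have h1 : 0 ≤ 2 / (1 + r ^ 2) := by positivity
  have h2 : 2 / (1 + r ^ 2) ≤ 2 := by rw [div_le_iff₀ h]; nlinarith [sq_nonneg r]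
  constructor <;> linarith

lemma stereo_sq (r : ℝ) : (1 - 2 / (1 + r ^ 2)) ^ 2 + (2 * r / (1 + r ^ 2)) ^ 2 = 1 := by
  have h : 1 + r ^ 2 ≠ 0 := by positivity
  field_simp
  ring

lemma continuous_stereo : Continuous fun r : ℝ => 1 - 2 / (1 + r ^ 2) := by
  have h : ∀ r : ℝ, 1 + r ^ 2 ≠ 0 := fun r => by positivity
  fun_prop (disch := exact h _)

lemma continuous_weight : Continuous fun r : ℝ => r ^ 6 / (1 + r ^ 2) ^ 7 := by
  have h : ∀ r : ℝ, (1 + r ^ 2) ^ 7 ≠ 0 := fun r => by positivity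
  fun_prop (disch := exact h _)

lemma integrable_weight_mul_eval (p : ℝ[X]) :
    Integrable fun r : ℝ => r ^ 6 / (1 + r ^ 2) ^ 7 * p.eval (1 - 2 / (1 + r ^ 2)) := by
  obtain ⟨B, hB⟩ := (isCompact_Icc (a := (-1 : ℝ)) (b := 1)).exists_bound_of_continuousOn
    p.continuous.continuousOn
  refine (integrable_inv_one_add_sq.mul_const B).mono'
    (continuous_weight.mul (p.continuous.comp continuous_stereo)).aestronglyMeasurable ?_
  refine Eventually.of_forall fun r => ?_
  rw [norm_mul]
  refine mul_le_mul ?_ (hB _ (stereo_mem r)) (norm_nonneg _) (by positivity)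
  rw [Real.norm_of_nonneg (by positivity), div_le_iff₀ (by positivity)]
  have h : (1 + r ^ 2)⁻¹ * (1 + r ^ 2) ^ 7 = (1 + r ^ 2) ^ 6 := by
    field_simp
  rw [h]
  calc r ^ 6 = (r ^ 2) ^ 3 := by ring
    _ ≤ (1 + r ^ 2) ^ 3 := by gcongr; linarith
    _ ≤ (1 + r ^ 2) ^ 6 := pow_le_pow_right₀ (by nlinarith [sq_nonneg r]) (by norm_num)

/-- The Gegenbauer moment functional, in the stereographic coordinate. -/
noncomputable def moment : ℝ[X] →ₗ[ℝ] ℝ where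
  toFun p := ∫ r in Set.Ioi (0 : ℝ), r ^ 6 / (1 + r ^ 2) ^ 7 * p.eval (1 - 2 / (1 + r ^ 2))
  map_add' p q := by
    rw [← integral_add (integrable_weight_mul_eval p).integrableOn
      (integrable_weight_mul_eval q).integrableOn]
    simp [mul_add]
  map_smul' c p := by
    simp only [RingHom.id_apply, smul_eq_mul]
    rw [← integral_const_mul]
    congr 1
    ext r
    simp
    ring

lemma moment_apply (p : ℝ[X]) : moment p =
    ∫ r in Set.Ioi (0 : ℝ), r ^ 6 / (1 + r ^ 2) ^ 7 * p.eval (1 - 2 / (1 + r ^ 2)) := rfl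

lemma tendsto_inv_one_add_sq : Tendsto (fun r : ℝ => (1 + r ^ 2)⁻¹) atTop (𝓝 0) :=
  tendsto_inv_atTop_zero.comp
    (tendsto_atTop_add_const_left _ 1 (tendsto_pow_atTop two_ne_zero))

lemma tendsto_div_one_add_sq : Tendsto (fun r : ℝ => r * (1 + r ^ 2)⁻¹) atTop (𝓝 0) := by
  refine squeeze_zero' ((eventually_ge_atTop 0).mono fun r hr => by positivity)
    ((eventually_gt_atTop 0).mono fun r hr => ?_) tendsto_inv_atTop_zero
  rw [← div_eq_mul_inv, div_le_iff₀ (by positivity), inv_mul_eq_div, le_div_iff₀ hr]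
  nlinarith

lemma moment_parts (p : ℝ[X]) : moment (7 * X * p - (1 - X ^ 2) * derivative p) = 0 := by
  have hd : ∀ r : ℝ, HasDerivAt
      (fun r : ℝ => r ^ 7 * ((1 + r ^ 2)⁻¹) ^ 7 * p.eval (1 - 2 * (1 + r ^ 2)⁻¹))
      (-(r ^ 6 / (1 + r ^ 2) ^ 7 *
        (7 * X * p - (1 - X ^ 2) * derivative p).eval (1 - 2 / (1 + r ^ 2)))) r := by
    intro r
    have h : 1 + r ^ 2 ≠ 0 := by positivity
    have h1 : HasDerivAt (fun r : ℝ => (1 + r ^ 2)⁻¹) (-(2 * r) / (1 + r ^ 2) ^ 2) r := by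
      have h0 : HasDerivAt (fun r : ℝ => 1 + r ^ 2) (2 * r) r := by
        simpa using (hasDerivAt_pow 2 r).const_add 1
      exact h0.inv h
    have h2 := (p.hasDerivAt (1 - 2 * (1 + r ^ 2)⁻¹)).comp r ((h1.const_mul 2).const_sub 1)
    refine (((hasDerivAt_pow 7 r).mul (h1.pow 7)).mul h2).congr_deriv ?_
    simp only [eval_mul, eval_sub, eval_pow, eval_X, eval_one, eval_ofNat, Pi.mul_apply,
      Function.comp, Pi.pow_apply, div_eq_mul_inv]
    generalize eval (1 - 2 * (1 + r ^ 2)⁻¹) p = P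
    generalize eval (1 - 2 * (1 + r ^ 2)⁻¹) (derivative p) = Q
    push_cast
    field_simp
    ring
  have hlim : Tendsto (fun r : ℝ => r ^ 7 * ((1 + r ^ 2)⁻¹) ^ 7 *
      p.eval (1 - 2 * (1 + r ^ 2)⁻¹)) atTop (𝓝 0) := by
    have h1 := tendsto_div_one_add_sq.pow 7
    have h2 := (p.continuous.tendsto _).comp ((tendsto_inv_one_add_sq.const_mul 2).const_sub 1)
    have := h1.mul h2
    simpa [mul_pow] using this
  have := integral_Ioi_of_hasDerivAt_of_tendsto' (a := 0) (fun r _ => hd r)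
    (integrable_weight_mul_eval _).neg.integrableOn hlim
  rw [integral_neg] at this
  rw [moment_apply]
  simpa using this

lemma moment_one : moment 1 = 5 * Real.pi / 2048 := by
  have hd : ∀ r : ℝ, HasDerivAt
      (fun r : ℝ => r * (1 + r ^ 2)⁻¹ * (5 / 1024 + 5 / 1536 * (1 + r ^ 2)⁻¹ +
        1 / 384 * ((1 + r ^ 2)⁻¹) ^ 2 - 9 / 64 * ((1 + r ^ 2)⁻¹) ^ 3 +
        5 / 24 * ((1 + r ^ 2)⁻¹) ^ 4 - 1 / 12 * ((1 + r ^ 2)⁻¹) ^ 5) + 5 / 1024 * Real.arctan r)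
      (r ^ 6 / (1 + r ^ 2) ^ 7 * (1 : ℝ[X]).eval (1 - 2 / (1 + r ^ 2))) r := by
    intro r
    have h : 1 + r ^ 2 ≠ 0 := by positivity
    have h1 : HasDerivAt (fun r : ℝ => (1 + r ^ 2)⁻¹) (-(2 * r) / (1 + r ^ 2) ^ 2) r := by
      have h0 : HasDerivAt (fun r : ℝ => 1 + r ^ 2) (2 * r) r := by
        simpa using (hasDerivAt_pow 2 r).const_add 1
      exact h0.inv h
    refine ((((hasDerivAt_id r).mul h1).mul ((((((h1.const_mul (5 / 1536)).const_add
      (5 / 1024)).add ((h1.pow 2).const_mul (1 / 384))).sub ((h1.pow 3).const_mul (9 / 64))).add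
      ((h1.pow 4).const_mul (5 / 24))).sub ((h1.pow 5).const_mul (1 / 12)))).add
      ((Real.hasDerivAt_arctan r).const_mul (5 / 1024))).congr_deriv ?_
    simp only [eval_one, Pi.mul_apply, Pi.add_apply, Pi.sub_apply, Pi.pow_apply, id]
    push_cast
    field_simp
    ring
  have hlim : Tendsto (fun r : ℝ => r * (1 + r ^ 2)⁻¹ * (5 / 1024 + 5 / 1536 * (1 + r ^ 2)⁻¹ +
        1 / 384 * ((1 + r ^ 2)⁻¹) ^ 2 - 9 / 64 * ((1 + r ^ 2)⁻¹) ^ 3 +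
        5 / 24 * ((1 + r ^ 2)⁻¹) ^ 4 - 1 / 12 * ((1 + r ^ 2)⁻¹) ^ 5) + 5 / 1024 * Real.arctan r)
      atTop (𝓝 (5 * Real.pi / 2048)) := by
    have hv := tendsto_inv_one_add_sq
    have := (tendsto_div_one_add_sq.mul ((((((hv.const_mul (5 / 1536)).const_add
      (5 / 1024)).add ((hv.pow 2).const_mul (1 / 384))).sub ((hv.pow 3).const_mul (9 / 64))).add
      ((hv.pow 4).const_mul (5 / 24))).sub ((hv.pow 5).const_mul (1 / 12)))).add
      ((tendsto_nhds_of_tendsto_nhdsWithin Real.tendsto_arctan_atTop).const_mul (5 / 1024))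
    convert this using 2
    ring
  rw [moment_apply, integral_Ioi_of_hasDerivAt_of_tendsto' (a := 0) (fun r _ => hd r)
    (integrable_weight_mul_eval _).integrableOn hlim]
  simp

lemma moment_C_mul (c : ℝ) (p : ℝ[X]) : moment (C c * p) = c * moment p := by
  rw [← smul_eq_C_mul, map_smul, smul_eq_mul]

lemma moment_gegenbauer_of_ne {i j : ℕ} (hij : i ≠ j) :
    moment (gegenbauer 3 i * gegenbauer 3 j) = 0 := by
  have h := moment_parts (gegenbauer 3 i * derivative (gegenbauer 3 j) -
    derivative (gegenbauer 3 i) * gegenbauer 3 j)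
  have hi := gegenbauer.ode 3 i
  have hj := gegenbauer.ode 3 j
  have h3 : (C 3 : ℝ[X]) = 3 := map_ofNat C 3
  rw [h3] at hi hj
  have e : (7 * X * (gegenbauer 3 i * derivative (gegenbauer 3 j) -
      derivative (gegenbauer 3 i) * gegenbauer 3 j) - (1 - X ^ 2) *
      derivative (gegenbauer 3 i * derivative (gegenbauer 3 j) -
        derivative (gegenbauer 3 i) * gegenbauer 3 j)) =
      C ((j : ℝ) * (j + 6) - i * (i + 6)) * (gegenbauer 3 i * gegenbauer 3 j) := by
    have hc : (C ((j : ℝ) * (j + 6) - i * (i + 6)) : ℝ[X]) =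
        (j : ℝ[X]) * (j + 6) - i * (i + 6) := by simp [map_ofNat]
    rw [hc]
    simp only [derivative_mul, derivative_sub]
    linear_combination gegenbauer 3 j * hi - gegenbauer 3 i * hj
  rw [e, moment_C_mul] at h
  refine (mul_eq_zero.1 h).resolve_left fun h0 => hij ?_
  have h1 : ((j : ℝ) - i) * (j + i + 6) = 0 := by linear_combination h0
  have h2 : (j : ℝ) = i := by
    have := (mul_eq_zero.1 h1).resolve_right (by positivity)
    linarith
  exact_mod_cast h2.symm

lemma moment_X_mul_succ (n i : ℕ) :
    2 * ((n : ℝ) + 4) * moment (X * gegenbauer 3 (n + 1) * gegenbauer 3 i) =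
      ((n : ℝ) + 2) * moment (gegenbauer 3 (n + 2) * gegenbauer 3 i) +
      ((n : ℝ) + 6) * moment (gegenbauer 3 n * gegenbauer 3 i) := by
  rw [← moment_C_mul, ← moment_C_mul, ← moment_C_mul, ← map_add]
  congr 1
  have h := gegenbauer.recurrence 3 n
  have h3 : (C 3 : ℝ[X]) = 3 := map_ofNat C 3
  rw [h3] at h
  have c1 : (C (2 * ((n : ℝ) + 4)) : ℝ[X]) = 2 * (n + 4) := by simp [map_ofNat]
  have c2 : (C ((n : ℝ) + 2) : ℝ[X]) = n + 2 := by simp [map_ofNat]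
  have c3 : (C ((n : ℝ) + 6) : ℝ[X]) = n + 6 := by simp [map_ofNat]
  rw [c1, c2, c3]
  linear_combination -gegenbauer 3 i * h

lemma moment_X_mul_zero (i : ℕ) : 6 * moment (X * gegenbauer 3 0 * gegenbauer 3 i) =
    moment (gegenbauer 3 1 * gegenbauer 3 i) := by
  rw [← moment_C_mul]
  congr 1
  have h3 : (C 3 : ℝ[X]) = 3 := map_ofNat C 3
  have h6 : (C 6 : ℝ[X]) = 6 := map_ofNat C 6
  rw [gegenbauer.zero, gegenbauer.one, h3, h6]
  ring

lemma moment_X_mul_self (n : ℕ) : moment (X * gegenbauer 3 n * gegenbauer 3 n) = 0 := by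
  cases n with
  | zero =>
    have := moment_X_mul_zero 0
    rw [moment_gegenbauer_of_ne (by norm_num)] at this
    linarith
  | succ n =>
    have := moment_X_mul_succ n (n + 1)
    rw [moment_gegenbauer_of_ne (by omega), moment_gegenbauer_of_ne (by omega)] at this
    have hn : 2 * ((n : ℝ) + 4) ≠ 0 := by positivity
    exact (mul_eq_zero.1 (by simpa using this)).resolve_left (by simpa using hn)

lemma moment_X_mul_succ_of_lt {n i : ℕ} (h : i < n) :
    moment (X * gegenbauer 3 (n + 1) * gegenbauer 3 i) = 0 := by
  have := moment_X_mul_succ n i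
  rw [moment_gegenbauer_of_ne (by omega), moment_gegenbauer_of_ne (by omega), mul_zero, mul_zero,
    add_zero] at this
  exact (mul_eq_zero.1 this).resolve_left (by positivity)

lemma moment_X_mul_succ_self (n : ℕ) :
    2 * ((n : ℝ) + 4) * moment (X * gegenbauer 3 (n + 1) * gegenbauer 3 n) =
      ((n : ℝ) + 6) * moment (gegenbauer 3 n * gegenbauer 3 n) := by
  rw [moment_X_mul_succ, moment_gegenbauer_of_ne (by omega)]
  ring

lemma moment_X_mul_self_succ (n : ℕ) :
    2 * ((n : ℝ) + 3) * moment (X * gegenbauer 3 (n + 1) * gegenbauer 3 n) =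
      ((n : ℝ) + 1) * moment (gegenbauer 3 (n + 1) * gegenbauer 3 (n + 1)) := by
  have e : X * gegenbauer 3 (n + 1) * gegenbauer 3 n =
    X * gegenbauer 3 n * gegenbauer 3 (n + 1) := by ring
  rw [e]
  cases n with
  | zero =>
    have := moment_X_mul_zero 1
    simp only [zero_add] at this ⊢
    push_cast
    linarith
  | succ n =>
    have := moment_X_mul_succ n (n + 2)
    rw [moment_gegenbauer_of_ne (i := n) (by omega)] at this
    push_cast
    linear_combination this

lemma moment_gegenbauer_self (n : ℕ) : gegenbauerCoeff n *
    moment (gegenbauer 3 n * gegenbauer 3 n) = Real.pi / 16384 := by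
  induction n with
  | zero => rw [gegenbauer.zero, mul_one, moment_one, gegenbauerCoeff]; norm_num; ring
  | succ n ih =>
    have h1 := moment_X_mul_succ_self n
    have h2 := moment_X_mul_self_succ n
    rw [← ih]
    have h : moment (gegenbauer 3 (n + 1) * gegenbauer 3 (n + 1)) =
        (n + 3) * (n + 6) / ((n + 1) * (n + 4)) * moment (gegenbauer 3 n * gegenbauer 3 n) := by
      field_simp
      linear_combination ((n : ℝ) + 3) * h1 - (n + 4) * h2
    rw [h, gegenbauerCoeff, gegenbauerCoeff]
    push_cast
    field_simp
    ring

/-- The partial sums of the series, without the constant factor. -/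
noncomputable def partialSum (N : ℕ) : ℝ[X] :=
  ∑ j ∈ Finset.range N, C (gegenbauerCoeff j) * gegenbauer 3 j

lemma moment_X_mul_partialSum (N : ℕ) :
    moment (X * gegenbauer 3 (N + 1) * partialSum (N + 1)) =
      Real.pi / 16384 * ((N + 6) / (2 * (N + 4))) := by
  have e : ∀ p : ℝ[X], ∀ M, moment (p * partialSum M) =
      ∑ j ∈ Finset.range M, gegenbauerCoeff j * moment (p * gegenbauer 3 j) := by
    intro p M
    rw [partialSum, Finset.mul_sum, map_sum]
    refine Finset.sum_congr rfl fun j _ => ?_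
    rw [← moment_C_mul]
    congr 1
    ring
  rw [e, Finset.sum_range_succ, Finset.sum_eq_zero, zero_add, ← moment_gegenbauer_self N]
  · have h1 := moment_X_mul_succ_self N
    field_simp
    linear_combination gegenbauerCoeff N * h1
  · intro j hj
    rw [moment_X_mul_succ_of_lt (Finset.mem_range.1 hj), mul_zero]

lemma moment_X_mul_partialSum_sq (N : ℕ) : moment (X * partialSum (N + 1) ^ 2) =
    Real.pi / 16384 * (1 / 72 - 1 / (3 * ((N + 2) * (N + 3) * (N + 4)))) := by
  induction N with
  | zero =>
    have : X * partialSum (0 + 1) ^ 2 = C (gegenbauerCoeff 0 ^ 2) *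
        (X * gegenbauer 3 0 * gegenbauer 3 0) := by
      simp [partialSum]; ring
    rw [this, moment_C_mul, moment_X_mul_self]
    norm_num
  | succ N ih =>
    have : X * partialSum (N + 1 + 1) ^ 2 = X * partialSum (N + 1) ^ 2 +
        (C (2 * gegenbauerCoeff (N + 1)) * (X * gegenbauer 3 (N + 1) * partialSum (N + 1)) +
        C (gegenbauerCoeff (N + 1) ^ 2) *
        (X * gegenbauer 3 (N + 1) * gegenbauer 3 (N + 1))) := by
      rw [partialSum, Finset.sum_range_succ, ← partialSum, C_mul, C_pow,
        show (C 2 : ℝ[X]) = 2 from map_ofNat C 2]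
      ring
    rw [this, map_add, map_add, moment_C_mul, moment_C_mul, moment_X_mul_self, ih,
      moment_X_mul_partialSum, gegenbauerCoeff]
    push_cast
    field_simp
    ring

lemma summable_one_div_succ_sq : Summable fun j : ℕ => 1 / ((j : ℝ) + 1) ^ 2 := by
  have := (summable_nat_add_iff 1).2 (Real.summable_one_div_nat_pow.2 one_lt_two)
  simpa using this

lemma abs_coeff_mul_gegenbauer_le {x s : ℝ} (hxs : x ^ 2 + s ^ 2 = 1) (j : ℕ) :
    |s ^ 3 * (gegenbauerCoeff j * (gegenbauer 3 j).eval x)| ≤ 1 / ((j : ℝ) + 1) ^ 2 := by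
  have hc : 0 ≤ gegenbauerCoeff j := by rw [gegenbauerCoeff]; positivity
  rw [mul_left_comm, abs_mul, abs_of_nonneg hc]
  refine (mul_le_mul_of_nonneg_left (gegenbauer_bound hxs j) hc).trans ?_
  rw [gegenbauerCoeff, one_div_mul_eq_div, div_le_div_iff₀ (by positivity) (by positivity)]
  have hj : (0 : ℝ) ≤ j := j.cast_nonneg
  have : ((j : ℝ) + 3) * (j + 1) ≤ (j + 4) * (j + 5) := by nlinarith
  calc ((j : ℝ) + 2) * (j + 3) * (j + 1) ^ 2 = ((j + 1) * (j + 2)) * ((j + 3) * (j + 1)) := by ring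
    _ ≤ ((j + 1) * (j + 2)) * ((j + 4) * (j + 5)) := by gcongr
    _ = _ := by ring

lemma summable_coeff_mul_gegenbauer {r : ℝ} (hr : 0 < r) : Summable fun j : ℕ =>
    gegenbauerCoeff j * (gegenbauer 3 j).eval (1 - 2 / (1 + r ^ 2)) := by
  have hs : (2 * r / (1 + r ^ 2)) ^ 3 ≠ 0 := by positivity
  exact (summable_mul_left_iff hs).1 (summable_one_div_succ_sq.of_norm_bounded
    fun j => abs_coeff_mul_gegenbauer_le (stereo_sq r) j)

lemma partialSum_eval (N : ℕ) (x : ℝ) : (partialSum N).eval x =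
    ∑ j ∈ Finset.range N, gegenbauerCoeff j * (gegenbauer 3 j).eval x := by
  simp [partialSum, eval_finsetSum]

lemma weight_mul_partialSum_sq_le (N : ℕ) (r : ℝ) :
    ‖r ^ 6 / (1 + r ^ 2) ^ 7 * (X * partialSum N ^ 2).eval (1 - 2 / (1 + r ^ 2))‖ ≤
      (∑' j : ℕ, 1 / ((j : ℝ) + 1) ^ 2) ^ 2 / 64 * (1 + r ^ 2)⁻¹ := by
  set M := ∑' j : ℕ, 1 / ((j : ℝ) + 1) ^ 2
  set x := 1 - 2 / (1 + r ^ 2) with hx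
  have hM : |(2 * r / (1 + r ^ 2)) ^ 3 * (partialSum N).eval x| ≤ M := by
    rw [partialSum_eval, Finset.mul_sum]
    refine (Finset.abs_sum_le_sum_abs _ _).trans ?_
    refine (Finset.sum_le_sum fun j _ => abs_coeff_mul_gegenbauer_le (stereo_sq r) j).trans ?_
    exact summable_one_div_succ_sq.sum_le_tsum _ fun j _ => by positivity
  have hx1 : |x| ≤ 1 := abs_le.2 (stereo_mem r)
  have e : r ^ 6 / (1 + r ^ 2) ^ 7 * (X * partialSum N ^ 2).eval x =
      x * (((2 * r / (1 + r ^ 2)) ^ 3 * (partialSum N).eval x) ^ 2 / 64 * (1 + r ^ 2)⁻¹) := by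
    simp only [eval_mul, eval_X, eval_pow]
    generalize x = y
    field_simp
    ring
  rw [e, norm_mul, Real.norm_eq_abs]
  refine (mul_le_of_le_one_left (norm_nonneg _) hx1).trans ?_
  rw [Real.norm_of_nonneg (by positivity), ← sq_abs]
  gcongr

lemma integral_weight_mul_tsum_sq :
    ∫ r in Set.Ioi (0 : ℝ), r ^ 6 / (1 + r ^ 2) ^ 7 * ((1 - 2 / (1 + r ^ 2)) *
      (∑' j : ℕ, gegenbauerCoeff j * (gegenbauer 3 j).eval (1 - 2 / (1 + r ^ 2))) ^ 2) =
      Real.pi / 16384 * (1 / 72) := by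
  have hdom : Tendsto (fun N : ℕ => moment (X * partialSum N ^ 2)) atTop
      (𝓝 (∫ r in Set.Ioi (0 : ℝ), r ^ 6 / (1 + r ^ 2) ^ 7 * ((1 - 2 / (1 + r ^ 2)) *
      (∑' j : ℕ, gegenbauerCoeff j * (gegenbauer 3 j).eval (1 - 2 / (1 + r ^ 2))) ^ 2))) := by
    refine tendsto_integral_of_dominated_convergence
      (fun r => (∑' j : ℕ, 1 / ((j : ℝ) + 1) ^ 2) ^ 2 / 64 * (1 + r ^ 2)⁻¹)
      (fun N => (integrable_weight_mul_eval _).integrableOn.aestronglyMeasurable)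
      (integrable_inv_one_add_sq.const_mul ((∑' j : ℕ, 1 / ((j : ℝ) + 1) ^ 2) ^ 2 / 64)).integrableOn
      (fun N => Eventually.of_forall fun r => weight_mul_partialSum_sq_le N r) ?_
    filter_upwards [ae_restrict_mem measurableSet_Ioi] with r hr
    simp only [eval_mul, eval_X, eval_pow, partialSum_eval]
    exact (((summable_coeff_mul_gegenbauer hr).hasSum.tendsto_sum_nat.pow 2).const_mul _).const_mul _
  have hlim : Tendsto (fun N : ℕ => moment (X * partialSum (N + 1) ^ 2)) atTop
      (𝓝 (Real.pi / 16384 * (1 / 72))) := by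
    simp only [moment_X_mul_partialSum_sq]
    have h0 : Tendsto (fun N : ℕ => 1 / (3 * (((N : ℝ) + 2) * (N + 3) * (N + 4)))) atTop (𝓝 0) := by
      refine squeeze_zero (fun N => by positivity) (fun N => ?_)
        (tendsto_one_div_add_atTop_nhds_zero_nat (𝕜 := ℝ))
      have hN : (0 : ℝ) ≤ N := N.cast_nonneg
      gcongr
      have : (1 : ℝ) ≤ (N + 3) * (N + 4) := by nlinarith
      nlinarith
    have := (h0.const_sub (1 / 72)).const_mul (Real.pi / 16384)
    rwa [sub_zero] at this
  exact tendsto_nhds_unique (hdom.comp (tendsto_add_atTop_nat 1)) hlim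

theorem stmt15 :
    (∀ r : ℝ, 0 < r →
      Summable (fun j : ℕ => |β j * jacobiP (5 / 2) j (1 - 2 / (1 + r ^ 2))|)) ∧
    (∫ r in Set.Ioi (0 : ℝ),
        r ^ 6 * (1 + r ^ 2) ^ (-7 : ℝ) * (1 - 2 / (1 + r ^ 2)) *
          (∑' j : ℕ, β j * jacobiP (5 / 2) j (1 - 2 / (1 + r ^ 2))) ^ 2)
      = 1 / 288 := by
  have hpos : ∀ r : ℝ, 0 < r → 0 < 1 - (1 - 2 / (1 + r ^ 2)) ^ 2 := by
    intro r hr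
    have h : 0 < (2 * r / (1 + r ^ 2)) ^ 2 := by positivity
    linarith [stereo_sq r]
  refine ⟨fun r hr => ?_, ?_⟩
  · simp only [beta_mul_jacobiP _ (hpos r hr)]
    exact ((summable_coeff_mul_gegenbauer hr).mul_left _).abs
  · have e : ∀ r ∈ Set.Ioi (0 : ℝ), r ^ 6 * (1 + r ^ 2) ^ (-7 : ℝ) * (1 - 2 / (1 + r ^ 2)) *
          (∑' j : ℕ, β j * jacobiP (5 / 2) j (1 - 2 / (1 + r ^ 2))) ^ 2 =
        4096 / Real.pi * (r ^ 6 / (1 + r ^ 2) ^ 7 * ((1 - 2 / (1 + r ^ 2)) *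
          (∑' j : ℕ, gegenbauerCoeff j *
            (gegenbauer 3 j).eval (1 - 2 / (1 + r ^ 2))) ^ 2)) := by
      intro r hr
      have h7 : (1 + r ^ 2) ^ (-7 : ℝ) = ((1 + r ^ 2) ^ 7)⁻¹ := by
        rw [Real.rpow_neg (by positivity)]
        norm_cast
      simp only [beta_mul_jacobiP _ (hpos r hr)]
      rw [tsum_mul_left, mul_pow, div_pow, Real.sq_sqrt Real.pi_pos.le, h7]
      ring
    rw [setIntegral_congr_fun measurableSet_Ioi e, integral_const_mul,
      integral_weight_mul_tsum_sq]
    have := Real.pi_ne_zero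
    field_simp
    norm_num
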